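/- There exist an absolute constant c > 0 and n₀ ∈ ℕ such that for all n ≥ n₀ the following holds. Let K ⊆ ℝⁿ be a centrally symmetric convex set with |vol(K) − 1/2| ≤ c, and let r* > 0 be such that α_K(r*) = vol(K). Then n/4 ≤ (r*)² ≤ 4n. -/

import Mathlib

open MeasureTheory ProbabilityTheory

/-- The standard Gaussian measure `N(0,1)ⁿ` on `ℝⁿ`. -/
noncomputable def stdGaussian (n : ℕ) : Measure (EuclideanSpace ℝ (Fin n)) :=
  (Measure.pi fun _ : Fin n => gaussianReal 0 1).map
    (EuclideanSpace.equiv (Fin n) ℝ).symm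

/-- The uniform (rotation-invariant) probability measure on the origin-centered sphere of
radius `r` in `ℝⁿ`. -/
noncomputable def sphereUniform (n : ℕ) (r : ℝ) : Measure (EuclideanSpace ℝ (Fin n)) :=
  (stdGaussian n).map (fun x => (r / ‖x‖) • x)

/-- The shell density `α_K(r)`. -/
noncomputable def shellDensity (n : ℕ) (K : Set (EuclideanSpace ℝ (Fin n))) (r : ℝ) : ℝ :=
  (sphereUniform n r K).toReal

/-- The Gaussian volume of `K ⊆ ℝⁿ`. -/
noncomputable def gaussVol (n : ℕ) (K : Set (EuclideanSpace ℝ (Fin n))) : ℝ :=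
  (stdGaussian n K).toReal

theorem stdGaussian_eq_probabilityTheory_stdGaussian (n : ℕ) :
    _root_.stdGaussian n = ProbabilityTheory.stdGaussian (EuclideanSpace ℝ (Fin n)) := by
  rw [← map_pi_eq_stdGaussian]
  rfl

instance isProbabilityMeasure_stdGaussian_euclidean (n : ℕ) :
    IsProbabilityMeasure (_root_.stdGaussian n) := by
  rw [stdGaussian_eq_probabilityTheory_stdGaussian]
  infer_instance

/-- Product measures of absolutely continuous factors are absolutely continuous. -/
theorem pi_absolutelyContinuous (n : ℕ) {μ ν : Measure ℝ} [SigmaFinite μ] [SigmaFinite ν]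
    (h : μ ≪ ν) : Measure.pi (fun _ : Fin n => μ) ≪ Measure.pi (fun _ : Fin n => ν) := by
  induction n with
  | zero => rw [Measure.pi_of_empty, Measure.pi_of_empty]
  | succ n ih =>
    have h₁ := (measurePreserving_piFinSuccAbove (fun _ : Fin (n + 1) => μ) 0).symm
    have h₂ := (measurePreserving_piFinSuccAbove (fun _ : Fin (n + 1) => ν) 0).symm
    rw [← h₁.map_eq, ← h₂.map_eq]
    exact (h.prod ih).map (MeasurableEquiv.measurable _)

theorem stdGaussian_absolutelyContinuous (n : ℕ) : _root_.stdGaussian n ≪ volume := by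
  have h := (pi_absolutelyContinuous n (gaussianReal_absolutelyContinuous 0 one_ne_zero)).map
    (PiLp.volume_preserving_toLp (Fin n)).measurable
  rw [← volume_pi, (PiLp.volume_preserving_toLp (Fin n)).map_eq] at h
  exact h

/-- A normalized linear combination of two independent standard Gaussian vectors is a standard
Gaussian vector. -/
theorem map_prod_stdGaussian (n : ℕ) {a b : ℝ} (hab : a ^ 2 + b ^ 2 = 1) :
    ((_root_.stdGaussian n).prod (_root_.stdGaussian n)).map
      (fun p => a • p.1 + b • p.2) = _root_.stdGaussian n := by
  have : IsProbabilityMeasure (((_root_.stdGaussian n).prod (_root_.stdGaussian n)).map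
      (fun p => a • p.1 + b • p.2)) :=
    Measure.isProbabilityMeasure_map (Measurable.aemeasurable (by fun_prop))
  apply Measure.ext_of_charFun
  ext t
  have key : charFun (((_root_.stdGaussian n).prod (_root_.stdGaussian n)).map
      (fun p => a • p.1 + b • p.2)) t
      = charFun (_root_.stdGaussian n) (a • t) * charFun (_root_.stdGaussian n) (b • t) := by
    rw [charFun_apply, integral_map (Measurable.aemeasurable (by fun_prop))
      (Measurable.aestronglyMeasurable (by fun_prop)), charFun_apply, charFun_apply,
      ← integral_prod_mul]
    congr 1
    ext p
    rw [← Complex.exp_add]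
    simp only [inner_add_left, real_inner_smul_left, real_inner_smul_right]
    push_cast
    ring_nf
  rw [key, stdGaussian_eq_probabilityTheory_stdGaussian]
  simp only [charFun_stdGaussian]
  rw [← Complex.exp_add, norm_smul, norm_smul]
  congr 1
  have h : ((|a| * ‖t‖) ^ 2 + (|b| * ‖t‖) ^ 2 : ℝ) = ‖t‖ ^ 2 := by
    rw [mul_pow, mul_pow, sq_abs, sq_abs, ← add_mul, hab, one_mul]
  simp only [Real.norm_eq_abs]
  rw [← add_div, ← neg_add]
  exact_mod_cast congrArg (fun r : ℝ => ((-r / 2 : ℝ) : ℂ)) h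

theorem memLp_sq_gaussianReal : MemLp (fun x : ℝ => x ^ 2) 2 (gaussianReal 0 1) := by
  have h := (memLp_id_gaussianReal' (μ := 0) (v := 1) 4 (by simp)).norm_rpow_div 2
  have e : (4 : ENNReal) / 2 = 2 := by
    rw [show (4 : ENNReal) = 2 * 2 by norm_num]
    exact ENNReal.mul_div_cancel_right (by simp) (by simp)
  rw [e] at h
  refine h.congr_norm (by fun_prop) (.of_forall fun x => ?_)
  simp

theorem integral_sq_gaussianReal : ∫ x, x ^ 2 ∂(gaussianReal 0 1) = 1 := by
  have h := variance_id_gaussianReal (μ := 0) (v := 1)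
  rw [variance_of_integral_eq_zero aemeasurable_id (by simp)] at h
  simpa using h

/-- The squared norm of a standard Gaussian vector concentrates around the dimension. -/
theorem stdGaussian_norm_sq_deviation_le (n : ℕ) {d : ℝ} (hd : 0 < d) :
    (_root_.stdGaussian n).real {x | d ≤ |‖x‖ ^ 2 - n|}
      ≤ n * Var[fun x : ℝ => x ^ 2; gaussianReal 0 1] / d ^ 2 := by
  set μ := Measure.pi fun _ : Fin n => gaussianReal 0 1
  set X : (Fin n → ℝ) → ℝ := ∑ i, fun ω => ω i ^ 2 with hX
  have hmem : ∀ i : Fin n, MemLp (fun ω : Fin n → ℝ => ω i ^ 2) 2 μ := fun i =>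
    memLp_sq_gaussianReal.comp_measurePreserving
      (measurePreserving_eval (fun _ : Fin n => gaussianReal 0 1) i)
  have hXmem : MemLp X 2 μ := memLp_finsetSum' _ fun i _ => hmem i
  have hvar : Var[X; μ] = n * Var[fun x : ℝ => x ^ 2; gaussianReal 0 1] := by
    rw [hX, variance_sum_pi (X := fun _ x => x ^ 2) fun _ => memLp_sq_gaussianReal]
    simp
  have hmean : μ[X] = (n : ℝ) := by
    simp only [hX, Finset.sum_apply]
    rw [integral_finsetSum _ fun i _ => (hmem i).integrable (by simp)]
    have (i : Fin n) : ∫ ω, ω i ^ 2 ∂μ = 1 := by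
      rw [← integral_sq_gaussianReal]
      exact integral_comp_eval (μ := fun _ : Fin n => gaussianReal 0 1) (i := i)
        (f := fun x : ℝ => x ^ 2) (by fun_prop)
    simp [this]
  have hcheb := meas_ge_le_variance_div_sq hXmem hd
  rw [hvar, hmean] at hcheb
  have hmap : (_root_.stdGaussian n) {x | d ≤ |‖x‖ ^ 2 - n|} = μ {ω | d ≤ |X ω - n|} := by
    rw [_root_.stdGaussian, Measure.map_apply (by fun_prop)
      (measurableSet_le (by fun_prop) (by fun_prop))]
    congr 1
    ext ω
    simp [EuclideanSpace.norm_sq_eq, hX]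
  rw [Measure.real, hmap]
  exact ENNReal.toReal_le_of_le_ofReal
    (div_nonneg (mul_nonneg n.cast_nonneg (variance_nonneg _ _)) (sq_nonneg _)) hcheb

section SymmetricConvex

variable {E : Type*} [AddCommGroup E] [Module ℝ E] {K : Set E}

theorem Convex.smul_mem_of_symm (hK : Convex ℝ K) (hsymm : ∀ x, x ∈ K ↔ -x ∈ K) {x : E}
    (hx : x ∈ K) {a : ℝ} (ha : |a| ≤ 1) : a • x ∈ K := by
  have h := abs_le.mp ha
  have := hK hx ((hsymm x).1 hx) (a := (1 + a) / 2) (b := (1 - a) / 2)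
    (by linarith) (by linarith) (by ring)
  convert this using 1
  module

theorem Convex.smul_add_smul_mem_of_symm (hK : Convex ℝ K) (hsymm : ∀ x, x ∈ K ↔ -x ∈ K)
    {x y : E} (hx : x ∈ K) (hy : y ∈ K) {a b : ℝ} (hab : |a| + |b| ≤ 1) :
    a • x + b • y ∈ K := by
  have aux : ∀ {c p : ℝ}, |c| ≤ p → |c / p| ≤ 1 ∧ p * (c / p) = c := by
    intro c p hcp
    have hp : 0 ≤ p := (abs_nonneg c).trans hcp
    refine ⟨by rw [abs_div, abs_of_nonneg hp]; exact div_le_one_of_le₀ hcp hp, ?_⟩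
    rcases hp.eq_or_lt with rfl | hp
    · rw [zero_mul, abs_eq_zero.mp (le_antisymm hcp (abs_nonneg c))]
    · field_simp
  have ha := abs_nonneg a
  have hb := abs_nonneg b
  obtain ⟨ha₁, ha₂⟩ := aux (c := a) (p := (1 + |a| - |b|) / 2) (by linarith)
  obtain ⟨hb₁, hb₂⟩ := aux (c := b) (p := (1 - |a| + |b|) / 2) (by linarith)
  have := hK (hK.smul_mem_of_symm hsymm hx ha₁) (hK.smul_mem_of_symm hsymm hy hb₁)
    (a := (1 + |a| - |b|) / 2) (b := (1 - |a| + |b|) / 2)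
    (by linarith) (by linarith) (by ring)
  rwa [smul_smul, smul_smul, ha₂, hb₂] at this

/-- The vectors obtained by rotating `p.1` towards `p.2` in steps of angle `π / 8`. -/
noncomputable def rotated (k : ℕ) (p : E × E) : E :=
  Real.cos (k * (Real.pi / 8)) • p.1 + Real.sin (k * (Real.pi / 8)) • p.2

theorem rotated_add_rotated (k j : ℕ) (p : E × E) :
    rotated k p + rotated (k + 2 * j) p
      = (2 * Real.cos (j * (Real.pi / 8))) • rotated (k + j) p := by
  have hc : Real.cos (k * (Real.pi / 8)) + Real.cos ((k + 2 * j : ℕ) * (Real.pi / 8))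
      = 2 * Real.cos (j * (Real.pi / 8)) * Real.cos ((k + j : ℕ) * (Real.pi / 8)) := by
    rw [Real.cos_add_cos, ← Real.cos_neg (j * (Real.pi / 8))]
    push_cast
    ring_nf
  have hs : Real.sin (k * (Real.pi / 8)) + Real.sin ((k + 2 * j : ℕ) * (Real.pi / 8))
      = 2 * Real.cos (j * (Real.pi / 8)) * Real.sin ((k + j : ℕ) * (Real.pi / 8)) := by
    have h₁ : (k : ℝ) * (Real.pi / 8) = (k + j : ℕ) * (Real.pi / 8) - j * (Real.pi / 8) := by
      push_cast; ring
    have h₂ : ((k + 2 * j : ℕ) : ℝ) * (Real.pi / 8)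
        = (k + j : ℕ) * (Real.pi / 8) + j * (Real.pi / 8) := by
      push_cast; ring
    rw [h₁, h₂, Real.sin_sub, Real.sin_add]
    ring
  simp only [rotated, smul_add, smul_smul, ← hc, ← hs]
  module

theorem rotated_add_eight (k : ℕ) (p : E × E) : rotated (k + 8) p = -rotated k p := by
  have h : ((k + 8 : ℕ) : ℝ) * (Real.pi / 8) = k * (Real.pi / 8) + Real.pi := by
    push_cast; ring
  simp only [rotated, h, Real.cos_add_pi, Real.sin_add_pi]
  module

theorem cos_pi_div_eight_mem_Icc : Real.cos (Real.pi / 8) ∈ Set.Icc (9 / 10 : ℝ) (37 / 40) := by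
  rw [Real.cos_pi_div_eight]
  have h₁ : (1.41 : ℝ) ≤ √2 := Real.le_sqrt_of_sq_le (by norm_num)
  have h₂ : √2 ≤ (1.42 : ℝ) := Real.sqrt_le_iff.mpr (by norm_num)
  have h₃ : (1.8 : ℝ) ≤ √(2 + √2) := Real.le_sqrt_of_sq_le (by norm_num; linarith)
  have h₄ : √(2 + √2) ≤ (1.85 : ℝ) := Real.sqrt_le_iff.mpr ⟨by norm_num, by norm_num; linarith⟩
  constructor <;> norm_num at * <;> linarith

variable {S T : Set E}

theorem rotated_succ_mem
    (hST : ∀ x ∈ S, ∀ y ∈ S, ∀ a b : ℝ, |a| + |b| ≤ 37 / 20 → a • x + b • y ∈ T)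
    {p : E × E} {k : ℕ} (h₀ : rotated k p ∈ S) (h₂ : rotated (k + 2) p ∈ S) :
    rotated (k + 1) p ∈ T ∧ rotated (k + 3) p ∈ T := by
  obtain ⟨hc₁, hc₂⟩ := cos_pi_div_eight_mem_Icc
  set c := Real.cos (Real.pi / 8)
  have e₁ : rotated k p + rotated (k + 2) p = (2 * c) • rotated (k + 1) p := by
    simpa [-Real.cos_pi_div_eight] using rotated_add_rotated k 1 p
  have e₂ : rotated (k + 1) p + rotated (k + 3) p = (2 * c) • rotated (k + 2) p := by
    simpa [-Real.cos_pi_div_eight] using rotated_add_rotated (k + 1) 1 p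
  have hinv : (2 * c)⁻¹ ≤ 37 / 40 := by
    rw [inv_le_comm₀ (by linarith) (by norm_num)]
    linarith
  have hpos : 0 < (2 * c)⁻¹ := inv_pos.mpr (by linarith)
  have f₁ : rotated (k + 1) p = (2 * c)⁻¹ • rotated k p + (2 * c)⁻¹ • rotated (k + 2) p := by
    rw [← smul_add, e₁, inv_smul_smul₀ (by linarith)]
  have f₂ : rotated (k + 3) p
      = (-(2 * c)⁻¹) • rotated k p + (2 * c - (2 * c)⁻¹) • rotated (k + 2) p := by
    rw [eq_sub_of_add_eq' e₂, f₁]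
    module
  refine ⟨f₁ ▸ hST _ h₀ _ h₂ _ _ ?_, f₂ ▸ hST _ h₀ _ h₂ _ _ ?_⟩
  · rw [abs_of_pos hpos]
    linarith
  · rw [abs_neg, abs_of_pos hpos, abs_of_pos (by linarith)]
    linarith

theorem rotated_add_two_mem
    (hST : ∀ x ∈ S, ∀ y ∈ S, ∀ a b : ℝ, |a| + |b| ≤ 37 / 20 → a • x + b • y ∈ T)
    {p : E × E} {k : ℕ} (h₀ : rotated k p ∈ S) (h₄ : rotated (k + 4) p ∈ S) :
    rotated (k + 2) p ∈ T := by
  have e : rotated k p + rotated (k + 4) p = √2 • rotated (k + 2) p := by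
    have h := rotated_add_rotated k 2 p
    rw [show ((2 : ℕ) : ℝ) * (Real.pi / 8) = Real.pi / 4 by push_cast; ring,
      Real.cos_pi_div_four] at h
    simpa [mul_div_cancel₀] using h
  have h₁ : (1.4 : ℝ) ≤ √2 := Real.le_sqrt_of_sq_le (by norm_num)
  have hinv : (√2)⁻¹ ≤ 37 / 40 := by
    rw [inv_le_comm₀ (by linarith) (by norm_num)]
    norm_num at *
    linarith
  have hpos : 0 < (√2)⁻¹ := inv_pos.mpr (by linarith)
  have f : rotated (k + 2) p = (√2)⁻¹ • rotated k p + (√2)⁻¹ • rotated (k + 4) p := by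
    rw [← smul_add, e, inv_smul_smul₀ (by linarith)]
  refine f ▸ hST _ h₀ _ h₄ _ _ ?_
  rw [abs_of_pos hpos]
  linarith

/-- If no rotated vector lies in `T \ S`, then two rotated vectors in `S` at angle `π / 4` force
all of them to lie in `S`. -/
theorem rotated_mem_of_mem_of_add_two_mem
    (hST : ∀ x ∈ S, ∀ y ∈ S, ∀ a b : ℝ, |a| + |b| ≤ 37 / 20 → a • x + b • y ∈ T)
    (hS : ∀ x, x ∈ S ↔ -x ∈ S) {p : E × E}
    (hTS : ∀ j, rotated j p ∈ T → rotated j p ∈ S) {k : ℕ} (hk : k ≤ 8)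
    (h₀ : rotated k p ∈ S) (h₂ : rotated (k + 2) p ∈ S) (j : ℕ) : rotated j p ∈ S := by
  have hall : ∀ i, rotated (k + i) p ∈ S ∧ rotated (k + i + 1) p ∈ S ∧
      rotated (k + i + 2) p ∈ S := by
    intro i
    induction i with
    | zero => exact ⟨h₀, hTS _ (rotated_succ_mem hST h₀ h₂).1, h₂⟩
    | succ i ih => exact ⟨ih.2.1, ih.2.2, hTS _ (rotated_succ_mem hST ih.1 ih.2.2).2⟩
  have h := (hall (j + (8 - k))).1
  rw [show k + (j + (8 - k)) = j + 8 by omega, rotated_add_eight] at h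
  exact (hS _).2 h

/-- The pointwise inequality whose expectation compares the measures of `S` and `T`. -/
theorem indicator_rotated_le (hsub : S ⊆ T)
    (hST : ∀ x ∈ S, ∀ y ∈ S, ∀ a b : ℝ, |a| + |b| ≤ 37 / 20 → a • x + b • y ∈ T)
    (hS : ∀ x, x ∈ S ↔ -x ∈ S) (hT : ∀ x, x ∈ T ↔ -x ∈ T) (p : E × E) :
    S.indicator (1 : E → ℝ) (rotated 0 p) + S.indicator 1 (rotated 2 p)
        + S.indicator 1 (rotated 4 p) + S.indicator 1 (rotated 6 p)
      ≤ 1 + 3 * (S.indicator 1 (rotated 0 p) * S.indicator 1 (rotated 4 p))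
        + 3 * ∑ k ∈ Finset.range 8,
          (T.indicator 1 (rotated k p) - S.indicator 1 (rotated k p)) := by
  have hle : ∀ x, S.indicator (1 : E → ℝ) x ≤ 1 := fun x =>
    Set.indicator_le_self' (fun _ _ => zero_le_one) x
  have hnn : ∀ x, 0 ≤ S.indicator (1 : E → ℝ) x := fun x =>
    Set.indicator_nonneg (fun _ _ => zero_le_one) x
  have hdiff : ∀ x, 0 ≤ T.indicator (1 : E → ℝ) x - S.indicator 1 x := fun x =>
    sub_nonneg.2 (Set.indicator_le_indicator_of_subset hsub (fun _ => zero_le_one) x)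
  have hsum : 0 ≤ ∑ k ∈ Finset.range 8,
      (T.indicator (1 : E → ℝ) (rotated k p) - S.indicator 1 (rotated k p)) :=
    Finset.sum_nonneg fun k _ => hdiff _
  by_cases hbad : ∃ k < 8, rotated k p ∈ T ∧ rotated k p ∉ S
  · obtain ⟨k, hk, hkT, hkS⟩ := hbad
    have hone : 1 ≤ ∑ k ∈ Finset.range 8,
        (T.indicator (1 : E → ℝ) (rotated k p) - S.indicator 1 (rotated k p)) := by
      refine le_trans (le_of_eq ?_)
        (Finset.single_le_sum (fun k _ => hdiff (rotated k p)) (Finset.mem_range.2 hk))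
      simp [hkT, hkS]
    nlinarith [hle (rotated 0 p), hle (rotated 2 p), hle (rotated 4 p), hle (rotated 6 p),
      mul_nonneg (hnn (rotated 0 p)) (hnn (rotated 4 p))]
  · push Not at hbad
    have hTS : ∀ j, rotated j p ∈ T → rotated j p ∈ S := by
      intro j
      induction j using Nat.strong_induction_on with
      | _ j ih =>
        intro hj
        by_cases h8 : j < 8
        · exact hbad j h8 hj
        · obtain ⟨i, rfl⟩ : ∃ i, j = i + 8 := ⟨j - 8, by omega⟩
          rw [rotated_add_eight] at hj ⊢
          exact (hS _).1 (ih i (by omega) ((hT _).2 hj))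
    have hadj := fun {k : ℕ} => rotated_mem_of_mem_of_add_two_mem (k := k) hST hS hTS
    have hopp := fun {k : ℕ} (h₀ : rotated k p ∈ S) (h₄ : rotated (k + 4) p ∈ S) =>
      hTS _ (rotated_add_two_mem hST h₀ h₄)
    by_cases hall : ∀ j, rotated j p ∈ S
    · simp only [Set.indicator_of_mem (hall _), Pi.one_apply] at hsum ⊢
      linarith
    · have h02 : ¬(rotated 0 p ∈ S ∧ rotated 2 p ∈ S) := fun h =>
        hall (hadj (by norm_num) h.1 h.2)
      have h24 : ¬(rotated 2 p ∈ S ∧ rotated 4 p ∈ S) := fun h =>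
        hall (hadj (by norm_num) h.1 h.2)
      have h46 : ¬(rotated 4 p ∈ S ∧ rotated 6 p ∈ S) := fun h =>
        hall (hadj (by norm_num) h.1 h.2)
      have h60 : ¬(rotated 6 p ∈ S ∧ rotated 0 p ∈ S) := fun h =>
        hall (hadj (k := 6) (by norm_num) h.1 (by
          rw [show 6 + 2 = 0 + 8 by rfl, rotated_add_eight]; exact (hS _).1 h.2))
      have h04 : ¬(rotated 0 p ∈ S ∧ rotated 4 p ∈ S) := fun h =>
        h02 ⟨h.1, hopp h.1 h.2⟩
      have h26 : ¬(rotated 2 p ∈ S ∧ rotated 6 p ∈ S) := fun h =>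
        h24 ⟨h.1, hopp h.1 h.2⟩
      have : S.indicator (1 : E → ℝ) (rotated 0 p) + S.indicator 1 (rotated 2 p)
          + S.indicator 1 (rotated 4 p) + S.indicator 1 (rotated 6 p) ≤ 1 := by
        classical
        clear hadj hopp hTS hall hST hS hT hbad hle hnn hdiff hsum
        simp only [Set.indicator_apply, Pi.one_apply]
        split_ifs <;> first | (norm_num; done) | (simp_all only [and_self, not_true_eq_false])
      linarith [mul_nonneg (hnn (rotated 0 p)) (hnn (rotated 4 p))]

end SymmetricConvex

theorem measurable_rotated {n : ℕ} (k : ℕ) :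
    Measurable (rotated k : EuclideanSpace ℝ (Fin n) × EuclideanSpace ℝ (Fin n) → _) := by
  unfold rotated
  fun_prop

theorem map_rotated_stdGaussian (n k : ℕ) :
    ((_root_.stdGaussian n).prod (_root_.stdGaussian n)).map (rotated k)
      = _root_.stdGaussian n :=
  map_prod_stdGaussian n (Real.cos_sq_add_sin_sq _)

theorem integrable_indicator_rotated {n : ℕ} (k : ℕ) {S : Set (EuclideanSpace ℝ (Fin n))}
    (hS : MeasurableSet S) :
    Integrable (fun p => S.indicator (1 : EuclideanSpace ℝ (Fin n) → ℝ) (rotated k p))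
      ((_root_.stdGaussian n).prod (_root_.stdGaussian n)) := by
  refine Integrable.of_bound (C := 1) ?_ (.of_forall fun p => ?_)
  · exact ((measurable_one.indicator hS).comp (measurable_rotated k)).aestronglyMeasurable
  · by_cases h : rotated k p ∈ S <;> simp [h]

theorem integral_indicator_rotated {n : ℕ} (k : ℕ) {S : Set (EuclideanSpace ℝ (Fin n))}
    (hS : MeasurableSet S) :
    ∫ p, S.indicator (1 : EuclideanSpace ℝ (Fin n) → ℝ) (rotated k p)
      ∂((_root_.stdGaussian n).prod (_root_.stdGaussian n)) = (_root_.stdGaussian n).real S := by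
  rw [← integral_map (φ := rotated k) (measurable_rotated k).aemeasurable
    (measurable_one.indicator hS).aestronglyMeasurable, map_rotated_stdGaussian,
    integral_indicator_one hS]

/-- If `T` contains the dilation of the symmetric set `S` by `37 / 20` in the sense of the
hypothesis `hST`, then `T` has a definite excess of Gaussian measure over `S`. -/
theorem stdGaussian_real_dilation_le {n : ℕ} {S T : Set (EuclideanSpace ℝ (Fin n))}
    (hSm : MeasurableSet S) (hTm : MeasurableSet T) (hsub : S ⊆ T)
    (hST : ∀ x ∈ S, ∀ y ∈ S, ∀ a b : ℝ, |a| + |b| ≤ 37 / 20 → a • x + b • y ∈ T)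
    (hS : ∀ x, x ∈ S ↔ -x ∈ S) (hT : ∀ x, x ∈ T ↔ -x ∈ T) :
    4 * (_root_.stdGaussian n).real S ≤ 1 + 3 * (_root_.stdGaussian n).real S ^ 2
      + 24 * ((_root_.stdGaussian n).real T - (_root_.stdGaussian n).real S) := by
  have hiS := fun k => integrable_indicator_rotated k hSm
  have hiT := fun k => integrable_indicator_rotated k hTm
  have hprod : (fun p : EuclideanSpace ℝ (Fin n) × EuclideanSpace ℝ (Fin n) =>
      S.indicator (1 : EuclideanSpace ℝ (Fin n) → ℝ) (rotated 0 p) * S.indicator 1 (rotated 4 p))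
      = fun p => S.indicator (1 : EuclideanSpace ℝ (Fin n) → ℝ) p.1 * S.indicator 1 p.2 := by
    ext p
    have h : (4 : ℝ) * (Real.pi / 8) = Real.pi / 2 := by ring
    simp [rotated, h]
  have hiprod : Integrable (fun p : EuclideanSpace ℝ (Fin n) × EuclideanSpace ℝ (Fin n) =>
      S.indicator (1 : EuclideanSpace ℝ (Fin n) → ℝ) (rotated 0 p) * S.indicator 1 (rotated 4 p))
      ((_root_.stdGaussian n).prod (_root_.stdGaussian n)) := by
    rw [hprod]
    exact Integrable.mul_prod ((integrable_const 1).indicator hSm)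
      ((integrable_const 1).indicator hSm)
  have hisum := integrable_finsetSum (Finset.range 8) fun k _ => (hiT k).sub (hiS k)
  have h := integral_mono (((hiS 0).add (hiS 2)).add (hiS 4) |>.add (hiS 6))
    (((integrable_const (1 : ℝ)).add (hiprod.const_mul 3)).add (hisum.const_mul 3))
    (fun p => indicator_rotated_le hsub hST hS hT p)
  rw [integral_add' (((hiS 0).add (hiS 2)).add (hiS 4)) (hiS 6),
    integral_add' ((hiS 0).add (hiS 2)) (hiS 4), integral_add' (hiS 0) (hiS 2),
    integral_add' ((integrable_const (1 : ℝ)).add (hiprod.const_mul 3)) (hisum.const_mul 3),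
    integral_add' (integrable_const (1 : ℝ)) (hiprod.const_mul 3), integral_const_mul,
    integral_const_mul, hprod, integral_prod_mul, integral_finsetSum _
      fun k _ => (hiT k).sub (hiS k)] at h
  simp only [Pi.sub_apply, integral_sub (hiT _) (hiS _), integral_indicator_rotated _ hSm,
    integral_indicator_rotated _ hTm, integral_indicator_one hSm] at h
  simp at h
  linarith

theorem Convex.stdGaussian_frontier {n : ℕ} {K : Set (EuclideanSpace ℝ (Fin n))}
    (hK : Convex ℝ K) : _root_.stdGaussian n (frontier K) = 0 :=
  stdGaussian_absolutelyContinuous n (hK.addHaar_frontier volume)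

/-- Specialization of the dilation estimate to a convex symmetric set and its contraction. -/
theorem Convex.stdGaussian_real_contraction_le {n : ℕ} {K : Set (EuclideanSpace ℝ (Fin n))}
    (hK : Convex ℝ K) (hsymm : ∀ x, x ∈ K ↔ -x ∈ K) (hm : MeasurableSet K) {s : ℝ}
    (hs : s = (_root_.stdGaussian n).real {x | (37 / 20 : ℝ) • x ∈ K}) :
    4 * s ≤ 1 + 3 * s ^ 2 + 24 * ((_root_.stdGaussian n).real K - s) := by
  subst hs
  have hcomb : ∀ x ∈ {x | (37 / 20 : ℝ) • x ∈ K}, ∀ y ∈ {x | (37 / 20 : ℝ) • x ∈ K},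
      ∀ a b : ℝ, |a| + |b| ≤ 37 / 20 → a • x + b • y ∈ K := by
    intro x hx y hy a b hab
    have := hK.smul_add_smul_mem_of_symm hsymm hx hy (a := a / (37 / 20)) (b := b / (37 / 20))
      (by rw [abs_div a, abs_div b, abs_of_pos (by norm_num : (0 : ℝ) < 37 / 20), ← add_div]
          exact div_le_one_of_le₀ hab (by norm_num))
    simpa [smul_smul] using this
  refine stdGaussian_real_dilation_le (hm.preimage (measurable_const_smul _)) hm ?_ hcomb ?_ hsymm
  · intro x hx
    simpa using hcomb x hx x hx 1 0 (by norm_num)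
  · intro x
    simp only [Set.mem_ofPred_eq, smul_neg]
    exact hsymm _

theorem stdGaussian_real_norm_sq_deviation_lt {n : ℕ} (hn : 0 < n) {ε : ℝ}
    (h : Var[fun x : ℝ => x ^ 2; gaussianReal 0 1] / (49 / 2500 * ε) < n) (hε : 0 < ε) :
    (_root_.stdGaussian n).real {x | 7 / 50 * (n : ℝ) ≤ |‖x‖ ^ 2 - n|} < ε := by
  have hn' : (0 : ℝ) < n := Nat.cast_pos.2 hn
  refine (stdGaussian_norm_sq_deviation_le n (by positivity)).trans_lt ?_
  rw [div_lt_iff₀ (by positivity)] at h ⊢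
  nlinarith

/-- Radial projections onto a sphere of radius `r` are measurable. -/
theorem measurable_div_norm_smul {n : ℕ} (r : ℝ) :
    Measurable fun x : EuclideanSpace ℝ (Fin n) => (r / ‖x‖) • x := by
  fun_prop

theorem shellDensity_eq {n : ℕ} {K : Set (EuclideanSpace ℝ (Fin n))} (hK : MeasurableSet K)
    (r : ℝ) :
    shellDensity n K r = (_root_.stdGaussian n).real {x | (r / ‖x‖) • x ∈ K} := by
  rw [shellDensity, sphereUniform, Measure.map_apply (measurable_div_norm_smul r) hK]
  rfl

theorem shellDensity_mono {n : ℕ} {K L : Set (EuclideanSpace ℝ (Fin n))} (h : K ⊆ L) (r : ℝ) :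
    shellDensity n K r ≤ shellDensity n L r := by
  have : IsProbabilityMeasure (sphereUniform n r) :=
    Measure.isProbabilityMeasure_map (measurable_div_norm_smul r).aemeasurable
  exact ENNReal.toReal_mono (measure_ne_top _ _) (measure_mono h)

theorem shellDensity_le {n : ℕ} {K : Set (EuclideanSpace ℝ (Fin n))}
    (hK : Convex ℝ K) (hsymm : ∀ x, x ∈ K ↔ -x ∈ K) (hm : MeasurableSet K) {r : ℝ} (hr : 0 < r)
    (hrn : 4 * n ≤ r ^ 2) :
    shellDensity n K r ≤ (_root_.stdGaussian n).real {x | (37 / 20 : ℝ) • x ∈ K}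
      + (_root_.stdGaussian n).real {x | 7 / 50 * (n : ℝ) ≤ |‖x‖ ^ 2 - n|} := by
  rw [shellDensity_eq hm]
  refine (measureReal_mono ?_).trans (measureReal_union_le _ _)
  intro x hx
  by_cases hxr : 37 / 20 * ‖x‖ ≤ r
  · left
    rcases eq_or_ne x 0 with rfl | hx0
    · simpa using hx
    · have hx0' := norm_ne_zero_iff.2 hx0
      have := hK.smul_mem_of_symm hsymm hx (a := 37 / 20 * ‖x‖ / r)
        (by rw [abs_of_nonneg (by positivity)]; exact div_le_one_of_le₀ hxr hr.le)
      rwa [smul_smul, show 37 / 20 * ‖x‖ / r * (r / ‖x‖) = 37 / 20 by field_simp] at this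
  · right
    simp only [Set.mem_ofPred_eq]
    refine le_trans ?_ (le_abs_self _)
    push Not at hxr
    nlinarith [n.cast_nonneg (α := ℝ)]

theorem le_shellDensity {n : ℕ} {K : Set (EuclideanSpace ℝ (Fin n))}
    (hK : Convex ℝ K) (hsymm : ∀ x, x ∈ K ↔ -x ∈ K) (hm : MeasurableSet K) {r : ℝ} (hr : 0 < r)
    (hrn : r ^ 2 ≤ n / 4) :
    (_root_.stdGaussian n).real {x | (20 / 37 : ℝ) • x ∈ K}
      ≤ shellDensity n K r
        + (_root_.stdGaussian n).real {x | 7 / 50 * (n : ℝ) ≤ |‖x‖ ^ 2 - n|} := by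
  rw [shellDensity_eq hm]
  refine (measureReal_mono ?_).trans (measureReal_union_le _ _)
  intro x hx
  by_cases hxr : 37 / 20 * r ≤ ‖x‖
  · left
    have hx0 : 0 < ‖x‖ := lt_of_lt_of_le (by positivity) hxr
    have := hK.smul_mem_of_symm hsymm hx (a := 37 / 20 * r / ‖x‖)
      (by rw [abs_of_nonneg (by positivity)]; exact div_le_one_of_le₀ hxr hx0.le)
    rwa [smul_smul, show 37 / 20 * r / ‖x‖ * (20 / 37) = r / ‖x‖ by field_simp] at this
  · right
    simp only [Set.mem_ofPred_eq]
    refine le_trans ?_ (neg_le_abs _)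
    push Not at hxr
    nlinarith [n.cast_nonneg (α := ℝ), norm_nonneg x]

theorem gaussVol_closure {n : ℕ} {K : Set (EuclideanSpace ℝ (Fin n))} (hK : Convex ℝ K) :
    (_root_.stdGaussian n).real (closure K) = gaussVol n K := by
  rw [gaussVol, Measure.real,
    measure_congr (closure_ae_eq_of_null_frontier hK.stdGaussian_frontier)]

theorem gaussVol_interior {n : ℕ} {K : Set (EuclideanSpace ℝ (Fin n))} (hK : Convex ℝ K) :
    (_root_.stdGaussian n).real (interior K) = gaussVol n K := by
  rw [gaussVol, Measure.real,
    measure_congr (interior_ae_eq_of_null_frontier hK.stdGaussian_frontier)]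

/-- For a centrally symmetric convex set `K` with `|vol(K) - 1/2| ≤ c`, any radius
`r* > 0` with `α_K(r*) = vol(K)` satisfies `n/4 ≤ (r*)² ≤ 4n`. -/
theorem rstar_bounds :
    ∃ c : ℝ, 0 < c ∧ ∃ n₀ : ℕ, ∀ n : ℕ, n₀ ≤ n →
      ∀ K : Set (EuclideanSpace ℝ (Fin n)),
        Convex ℝ K → (∀ x, x ∈ K ↔ -x ∈ K) →
        |gaussVol n K - 1 / 2| ≤ c →
        ∀ rstar : ℝ, 0 < rstar →
          shellDensity n K rstar = gaussVol n K →
          (n : ℝ) / 4 ≤ rstar ^ 2 ∧ rstar ^ 2 ≤ 4 * n := by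
  obtain ⟨n₀, hn₀⟩ := exists_nat_gt
    (Var[fun x : ℝ => x ^ 2; gaussianReal 0 1] / (49 / 2500 * (1 / 200)))
  refine ⟨1 / 100, by norm_num, n₀ + 1, fun n hn K hK hsymm hvol r hr hα => ?_⟩
  have hdev := stdGaussian_real_norm_sq_deviation_lt (n := n) (ε := 1 / 200) (by omega)
    (hn₀.trans_le (by exact_mod_cast (by omega : n₀ ≤ n))) (by norm_num)
  obtain ⟨hv₁, hv₂⟩ := abs_le.1 hvol
  have hneg : -K = K := by
    ext x
    exact (hsymm x).symm
  constructor
  · by_contra! hlt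
    have hsymm' : ∀ x, x ∈ interior K ↔ -x ∈ interior K := fun x => by
      have h := (Homeomorph.neg (EuclideanSpace ℝ (Fin n))).preimage_interior K
      rw [show Homeomorph.neg (EuclideanSpace ℝ (Fin n)) ⁻¹' K = K from hneg] at h
      exact (Set.ext_iff.1 h x).symm
    have hscale : Convex ℝ {x | (20 / 37 : ℝ) • x ∈ interior K} :=
      hK.interior.linear_preimage (LinearMap.lsmul ℝ _ (20 / 37 : ℝ))
    have hscale_symm : ∀ x, x ∈ {x | (20 / 37 : ℝ) • x ∈ interior K} ↔
        -x ∈ {x | (20 / 37 : ℝ) • x ∈ interior K} := fun x => by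
      simp only [Set.mem_ofPred_eq, smul_neg]
      exact hsymm' _
    have h := le_shellDensity hK.interior hsymm' isOpen_interior.measurableSet hr hlt.le
    have hmono := shellDensity_mono (interior_subset : interior K ⊆ K) r
    have hgap := hscale.stdGaussian_real_contraction_le hscale_symm
      (isOpen_interior.measurableSet.preimage (measurable_const_smul _))
      (s := gaussVol n K) (by
        rw [← gaussVol_interior hK]
        simp [smul_smul])
    nlinarith
  · by_contra! hlt
    have hsymm' : ∀ x, x ∈ closure K ↔ -x ∈ closure K := fun x => by
      have h := (Homeomorph.neg (EuclideanSpace ℝ (Fin n))).preimage_closure K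
      rw [show Homeomorph.neg (EuclideanSpace ℝ (Fin n)) ⁻¹' K = K from hneg] at h
      exact (Set.ext_iff.1 h x).symm
    have h := shellDensity_le hK.closure hsymm' isClosed_closure.measurableSet hr hlt.le
    have hmono := shellDensity_mono (subset_closure : K ⊆ closure K) r
    have hgap := hK.closure.stdGaussian_real_contraction_le hsymm'
      isClosed_closure.measurableSet rfl
    have hle : (_root_.stdGaussian n).real {x | (37 / 20 : ℝ) • x ∈ closure K}
        ≤ gaussVol n K := by
      rw [← gaussVol_closure hK]
      refine measureReal_mono fun x hx => ?_
      have := hK.closure.smul_mem_of_symm hsymm' hx (a := 20 / 37)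
        (by rw [abs_of_pos] <;> norm_num)
      simpa [smul_smul] using this
    rw [gaussVol_closure hK] at hgap
    nlinarith
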